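/- arXiv:1708.06146 — 13 statements merged into one kernel-verified Lean document; each statement's English description precedes it below -/
import Mathlib

section
/- Let n be a positive integer and a < b < c elements of C_n. If α ∈ △^(n){a,b,c} has type (a,b,c) (i.e., α(a)=a, α(b)=b, α(c)=c, so that α is a right identity of the triangle), then the Jordan map ∂_α is a derivation on the whole triangle: for all β, γ ∈ △^(n){a,b,c}, ∂_α(βγ) = ∂_α(β)γ + β∂_α(γ). -/
/-- Semiring multiplication on endomorphisms of the chain `C_n`: `(f * g)(x) = g (f x)`. -/
def emul {n : ℕ} (f g : Fin n → Fin n) : Fin n → Fin n := fun x => g (f x)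

/-- Semiring addition on endomorphisms of the chain `C_n`: `(f + g)(x) = max (f x) (g x)`. -/
def eadd {n : ℕ} (f g : Fin n → Fin n) : Fin n → Fin n := fun x => max (f x) (g x)

/-- The Jordan map `∂_f g = f * g + g * f`. -/
def jord {n : ℕ} (f g : Fin n → Fin n) : Fin n → Fin n := eadd (emul f g) (emul g f)

/-- Membership in the triangle `△^(n){a,b,c}`: monotone with image contained in `{a,b,c}`. -/
def inTriangle {n : ℕ} (a b c : Fin n) (f : Fin n → Fin n) : Prop :=
  Monotone f ∧ ∀ x, f x = a ∨ f x = b ∨ f x = c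

theorem jordan_deriv_type_abc {n : ℕ} (a b c : Fin n) (hab : a < b) (hbc : b < c)
    (α : Fin n → Fin n) (hα : inTriangle a b c α)
    (hta : α a = a) (htb : α b = b) (htc : α c = c)
    (β γ : Fin n → Fin n) (hβ : inTriangle a b c β) (hγ : inTriangle a b c γ) :
    jord α (emul β γ) = eadd (emul (jord α β) γ) (emul β (jord α γ)) := by
  have h : ∀ f : Fin n → Fin n, inTriangle a b c f → ∀ x, α (f x) = f x := by
    intro f hf x
    rcases hf.2 x with h | h | h <;> rw [h] <;> assumption
  funext x
  simp only [jord, eadd, emul, h β hβ, h γ hγ, hγ.1.map_max, max_self]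
  rw [max_assoc, max_self]
end

section
/- Let n be a positive integer and a < b < c elements of C_n. If α ∈ △^(n){a,b,c} has type (a,a,a) (i.e., α(a)=α(b)=α(c)=a), then the Jordan map ∂_α is a derivation on the whole triangle: for all β, γ ∈ △^(n){a,b,c}, ∂_α(βγ) = ∂_α(β)γ + β∂_α(γ). -/
theorem jordan_deriv_type_aaa {n : ℕ} (a b c : Fin n) (hab : a < b) (hbc : b < c)
    (α : Fin n → Fin n) (hα : inTriangle a b c α)
    (hta : α a = a) (htb : α b = a) (htc : α c = a)
    (β γ : Fin n → Fin n) (hβ : inTriangle a b c β) (hγ : inTriangle a b c γ) :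
    jord α (emul β γ) = eadd (emul (jord α β) γ) (emul β (jord α γ)) := by
  have key : ∀ f : Fin n → Fin n, inTriangle a b c f → ∀ x, a ≤ f x ∧ α (f x) = a := by
    intro f hf x
    rcases hf.2 x with h | h | h <;> rw [h]
    · exact ⟨le_refl _, hta⟩
    · exact ⟨hab.le, htb⟩
    · exact ⟨(hab.trans hbc).le, htc⟩
  funext x
  simp only [jord, eadd, emul]
  rw [(key γ hγ (β x)).2, (key β hβ x).2, max_eq_left (key β hβ (α x)).1,
    max_eq_left (key γ hγ (β (α x))).1, max_eq_left (key γ hγ a).1,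
    max_eq_left (hγ.1 (key β hβ (α x)).1)]
end

section
/- Let n be a positive integer and a < b < c elements of C_n. If α ∈ △^(n){a,b,c} has type (c,c,c) (i.e., α(a)=α(b)=α(c)=c), then the Jordan map ∂_α is a derivation on the whole triangle: for all β, γ ∈ △^(n){a,b,c}, ∂_α(βγ) = ∂_α(β)γ + β∂_α(γ). -/
theorem jordan_deriv_type_ccc {n : ℕ} (a b c : Fin n) (hab : a < b) (hbc : b < c)
    (α : Fin n → Fin n) (hα : inTriangle a b c α)
    (hta : α a = c) (htb : α b = c) (htc : α c = c)
    (β γ : Fin n → Fin n) (hβ : inTriangle a b c β) (hγ : inTriangle a b c γ) :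
    jord α (emul β γ) = eadd (emul (jord α β) γ) (emul β (jord α γ)) := by
  have hA : ∀ f : Fin n → Fin n, inTriangle a b c f → ∀ x, α (f x) = c := by
    intro f hf x
    rcases hf.2 x with h | h | h <;> rw [h] <;> assumption
  have hle : ∀ f : Fin n → Fin n, inTriangle a b c f → ∀ x, f x ≤ c := by
    intro f hf x
    rcases hf.2 x with h | h | h <;> rw [h]
    · exact (hab.trans hbc).le
    · exact hbc.le
  funext x
  simp only [jord, emul, eadd]
  rw [hA γ hγ (β x), max_eq_right (hle γ hγ _), max_eq_right (hle γ hγ (α (β x))),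
    max_eq_right (hle γ hγ _)]
end

section
/- Let n be a positive integer and a < b < c elements of C_n. Let α ∈ △^(n){a,b,c} have type (b,b,b) (i.e., α(a)=α(b)=α(c)=b), and let D_{(b,b,b)} be the set of all β ∈ △^(n){a,b,c} that are not of type (a,c,c) or (b,c,c), i.e., D_{(b,b,b)} = {β ∈ △^(n){a,b,c} : β(b) ≤ b or β(a) = c}. Then the Jordan map ∂_α is a derivation on D_{(b,b,b)}: for all β, γ ∈ D_{(b,b,b)}, ∂_α(βγ) = ∂_α(β)γ + β∂_α(γ). -/
theorem jordan_deriv_type_bbb {n : ℕ} (a b c : Fin n) (hab : a < b) (hbc : b < c)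
    (α : Fin n → Fin n) (hα : inTriangle a b c α)
    (hta : α a = b) (htb : α b = b) (htc : α c = b)
    (β γ : Fin n → Fin n) (hβ : inTriangle a b c β) (hγ : inTriangle a b c γ)
    (hβD : β b ≤ b ∨ β a = c) (hγD : γ b ≤ b ∨ γ a = c) :
    jord α (emul β γ) = eadd (emul (jord α β) γ) (emul β (jord α γ)) := by
  have hα' : ∀ f : Fin n → Fin n, inTriangle a b c f → ∀ x, α (f x) = b := by
    intro f hf x
    rcases hf.2 x with h | h | h <;> rw [h] <;> assumption
  funext x
  simp only [jord, eadd, emul, hα' β hβ, hα' γ hγ, hγ.1.map_max]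
  have key : γ b ≤ max (γ (β (α x))) b := by
    rcases hγD with h | h
    · exact le_max_of_le_right h
    · have h1 : a ≤ β (α x) := by
        rcases hβ.2 (α x) with h | h | h <;> rw [h]
        · exact hab.le
        · exact (hab.trans hbc).le
      have h2 : c ≤ γ (β (α x)) := h ▸ hγ.1 h1
      have h3 : γ b ≤ c := by
        rcases hγ.2 b with h | h | h <;> rw [h]
        · exact (hab.trans hbc).le
        · exact hbc.le
      exact le_max_of_le_left (h3.trans h2)
  apply le_antisymm
  · exact max_le (le_max_of_le_left (le_max_left _ _)) (le_max_of_le_right (le_max_right _ _))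
  · exact max_le (max_le (le_max_left _ _) key) (max_le key (le_max_right _ _))
end

section
/- Let n be a positive integer and a < b < c elements of C_n. Let α ∈ △^(n){a,b,c} have type (a,b,b) (i.e., α(a)=a, α(b)=α(c)=b), and let D = {β ∈ △^(n){a,b,c} : β(b) ≤ b or β(a) = c} (all endomorphisms of the triangle except those of types (a,c,c) and (b,c,c)). Then the Jordan map ∂_α is a derivation on D: for all β, γ ∈ D, ∂_α(βγ) = ∂_α(β)γ + β∂_α(γ). -/
theorem jordan_deriv_type_abb {n : ℕ} (a b c : Fin n) (hab : a < b) (hbc : b < c)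
    (α : Fin n → Fin n) (hα : inTriangle a b c α)
    (hta : α a = a) (htb : α b = b) (htc : α c = b)
    (β γ : Fin n → Fin n) (hβ : inTriangle a b c β) (hγ : inTriangle a b c γ)
    (hβD : β b ≤ b ∨ β a = c) (hγD : γ b ≤ b ∨ γ a = c) :
    jord α (emul β γ) = eadd (emul (jord α β) γ) (emul β (jord α γ)) := by
  obtain ⟨hαm, hαi⟩ := hα
  obtain ⟨hβm, hβi⟩ := hβ
  obtain ⟨hγm, hγi⟩ := hγ
  funext x
  simp only [jord, emul, eadd]
  rw [hγm.map_max]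
  have key : γ (α (β x)) ≤ max (γ (β (α x))) (α (γ (β x))) := by
    rcases hγD with h | h
    · apply le_max_of_le_right
      have h1 : α (β x) ≤ β x := by
        rcases hβi x with e | e | e <;> rw [e]
        · exact hta.le
        · exact htb.le
        · exact htc.trans_le hbc.le
      have h2 : α (β x) ≤ b := by
        rcases hβi x with e | e | e <;> rw [e]
        · exact hta.trans_le hab.le
        · exact htb.le
        · exact htc.le
      have h3 : γ (α (β x)) ≤ b := (hγm h2).trans h
      have h4 : α (γ (α (β x))) = γ (α (β x)) := by
        rcases hγi (α (β x)) with e | e | e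
        · rw [e, hta]
        · rw [e, htb]
        · rw [e] at h3
          exact absurd h3 (not_le.mpr hbc)
      rw [← h4]
      exact hαm (hγm h1)
    · apply le_max_of_le_left
      have h1 : ∀ z, γ z ≤ c := fun z => by
        rcases hγi z with e | e | e <;> rw [e]
        · exact (hab.trans hbc).le
        · exact hbc.le
      have h2 : a ≤ β (α x) := by
        rcases hβi (α x) with e | e | e <;> rw [e]
        · exact hab.le
        · exact (hab.trans hbc).le
      exact (h1 _).trans (h ▸ hγm h2)
  apply le_antisymm
  · exact max_le (le_max_of_le_left (le_max_left _ _)) (le_max_of_le_right (le_max_right _ _))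
  · exact max_le (max_le (le_max_left _ _) key) (max_le key (le_max_right _ _))
end

section
/- Let n be a positive integer and a < b < c elements of C_n. Let α ∈ △^(n){a,b,c} have type (b,b,c) (i.e., α(a)=α(b)=b, α(c)=c), and let D = {β ∈ △^(n){a,b,c} : β(b) ≤ b or β(a) = c} (all endomorphisms of the triangle except those of types (a,c,c) and (b,c,c)). Then the Jordan map ∂_α is a derivation on D: for all β, γ ∈ D, ∂_α(βγ) = ∂_α(β)γ + β∂_α(γ). -/
theorem jordan_deriv_type_bbc {n : ℕ} (a b c : Fin n) (hab : a < b) (hbc : b < c)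
    (α : Fin n → Fin n) (hα : inTriangle a b c α)
    (hta : α a = b) (htb : α b = b) (htc : α c = c)
    (β γ : Fin n → Fin n) (hβ : inTriangle a b c β) (hγ : inTriangle a b c γ)
    (hβD : β b ≤ b ∨ β a = c) (hγD : γ b ≤ b ∨ γ a = c) :
    jord α (emul β γ) = eadd (emul (jord α β) γ) (emul β (jord α γ)) := by
  obtain ⟨hγm, hγi⟩ := hγ
  obtain ⟨hβm, hβi⟩ := hβ
  have hz : ∀ z, (z = a ∨ z = b ∨ z = c) → z ≤ α z ∧ b ≤ α z := by
    rintro z (rfl | rfl | rfl)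
    · rw [hta]; exact ⟨hab.le, le_rfl⟩
    · rw [htb]; exact ⟨le_rfl, le_rfl⟩
    · rw [htc]; exact ⟨le_rfl, hbc.le⟩
  have key : ∀ y, (y = a ∨ y = b ∨ y = c) → γ (α y) ≤ α (γ y) := by
    rintro y (rfl | rfl | rfl)
    · rw [hta]
      rcases hγD with h | h
      · exact h.trans (hz _ (hγi _)).2
      · rw [h, htc]
        rcases hγi b with h | h | h <;> rw [h]
        · exact (hab.trans hbc).le
        · exact hbc.le
    · rw [htb]; exact (hz _ (hγi _)).1
    · rw [htc]; exact (hz _ (hγi _)).1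
  funext x
  have h := key (β x) (hβi x)
  simp only [jord, eadd, emul, hγm.map_max]
  rw [max_eq_right h, max_assoc, max_eq_right h]
end

section
/- Let n be a positive integer and a < b < c elements of C_n. Let α ∈ △^(n){a,b,c} have type (a,c,c) (i.e., α(a)=a, α(b)=α(c)=c), and let D = {β ∈ △^(n){a,b,c} : β(b) ≥ b or β(c) = a} (all endomorphisms of the triangle except those of types (a,a,b) and (a,a,c)). Then the Jordan map ∂_α is a derivation on D: for all β, γ ∈ D, ∂_α(βγ) = ∂_α(β)γ + β∂_α(γ). -/
theorem jordan_deriv_type_acc {n : ℕ} (a b c : Fin n) (hab : a < b) (hbc : b < c)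
    (α : Fin n → Fin n) (hα : inTriangle a b c α)
    (hta : α a = a) (htb : α b = c) (htc : α c = c)
    (β γ : Fin n → Fin n) (hβ : inTriangle a b c β) (hγ : inTriangle a b c γ)
    (hβD : b ≤ β b ∨ β c = a) (hγD : b ≤ γ b ∨ γ c = a) :
    jord α (emul β γ) = eadd (emul (jord α β) γ) (emul β (jord α γ)) := by
  obtain ⟨hγm, hγi⟩ := hγ
  have hac : a < c := hab.trans hbc
  have hle : ∀ y, γ y ≤ α (γ y) := by
    intro y
    rcases hγi y with h | h | h <;> rw [h]
    · rw [hta]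
    · rw [htb]; exact hbc.le
    · rw [htc]
  have htop : ∀ y, γ y ≤ c := by
    intro y
    rcases hγi y with h | h | h <;> rw [h]
    · exact hac.le
    · exact hbc.le
  have hbot : ∀ y, a ≤ γ y := by
    intro y
    rcases hγi y with h | h | h <;> rw [h]
    · exact hab.le
    · exact hac.le
  have key : ∀ x, γ (α (β x)) ≤ α (γ (β x)) := by
    intro x
    rcases hβ.2 x with h | h | h <;> rw [h]
    · rw [hta]; exact hle a
    · rw [htb]
      rcases hγD with h1 | h1
      · have h2 : α (γ b) = c := by
          rcases hγi b with h3 | h3 | h3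
          · rw [h3] at h1; exact absurd hab (not_lt.mpr h1)
          · rw [h3, htb]
          · rw [h3, htc]
        rw [h2]; exact htop c
      · rw [h1]; exact (hbot b).trans (hle b)
    · rw [htc]; exact hle c
  funext x
  simp only [jord, eadd, emul, hγm.map_max]
  have := key x
  rw [max_eq_right this, max_assoc, max_eq_right this]
end

section
/- Let n be a positive integer and a < b < c elements of C_n. The set J = {β ∈ △^(n){a,b,c} : β(a) ≥ b} (the endomorphisms of the triangle whose types are (b,b,b), (b,b,c), (b,c,c) or (c,c,c)) is a Jordan ideal of △^(n){a,b,c}: J is closed under addition, and for every u ∈ J and every s ∈ △^(n){a,b,c} the Jordan product u∘s = us + su belongs to J. -/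
theorem eadd_tri {n : ℕ} (a b c : Fin n) (u v : Fin n → Fin n)
    (hu : inTriangle a b c u) (hv : inTriangle a b c v) : inTriangle a b c (eadd u v) := by
  refine ⟨fun x y h => max_le_max (hu.1 h) (hv.1 h), fun x => ?_⟩
  rcases max_choice (u x) (v x) with h | h
  · simpa only [eadd, h] using hu.2 x
  · simpa only [eadd, h] using hv.2 x

theorem jordan_ideal_triangle {n : ℕ} (a b c : Fin n) (hab : a < b) (hbc : b < c) :
    (∀ u v : Fin n → Fin n,
        inTriangle a b c u ∧ b ≤ u a → inTriangle a b c v ∧ b ≤ v a →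
        inTriangle a b c (eadd u v) ∧ b ≤ eadd u v a) ∧
    (∀ u s : Fin n → Fin n,
        inTriangle a b c u ∧ b ≤ u a → inTriangle a b c s →
        inTriangle a b c (eadd (emul u s) (emul s u)) ∧ b ≤ eadd (emul u s) (emul s u) a) := by
  refine ⟨fun u v hu hv => ⟨eadd_tri a b c u v hu.1 hv.1, le_max_of_le_left hu.2⟩,
    fun u s hu hs => ⟨eadd_tri a b c _ _ ⟨fun x y h => hs.1 (hu.1.1 h), fun x => hs.2 _⟩
      ⟨fun x y h => hu.1.1 (hs.1 h), fun x => hu.1.2 _⟩, ?_⟩⟩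
  have h : a ≤ s a := by
    rcases hs.2 a with h | h | h <;> rw [h]
    · exact hab.le
    · exact (hab.trans hbc).le
  exact le_max_of_le_right (hu.2.trans (hu.1.1 h))
end

section
/- Let n be a positive integer and a < b < c elements of C_n. Let α, β ∈ △^(n){a,b,c} be of the same type (i.e., α(a)=β(a), α(b)=β(b), α(c)=β(c)). Then the local derivations ∂_α and ∂_β commute on the semiring RI(△^(n){a,b,c}) of right identities of the triangle: for every γ ∈ △^(n){a,b,c} with γ(a)=a, γ(b)=b, γ(c)=c, one has ∂_α(∂_β(γ)) = ∂_β(∂_α(γ)). -/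
theorem local_derivations_commute_on_RI {n : ℕ} (a b c : Fin n) (hab : a < b) (hbc : b < c)
    (α β : Fin n → Fin n)
    (hα : inTriangle a b c α) (hβ : inTriangle a b c β)
    (hsa : α a = β a) (hsb : α b = β b) (hsc : α c = β c) :
    ∀ γ : Fin n → Fin n, inTriangle a b c γ → γ a = a → γ b = b → γ c = c →
      jord α (jord β γ) = jord β (jord α γ) := by
  intro γ hγ ga gb gc
  have hT : ∀ y, (y = a ∨ y = b ∨ y = c) → α y = β y ∧ γ y = y := by
    rintro y (rfl | rfl | rfl)
    · exact ⟨hsa, ga⟩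
    · exact ⟨hsb, gb⟩
    · exact ⟨hsc, gc⟩
  funext x
  have e1 := hT _ (hα.2 x)
  have e2 := hT _ (hβ.2 x)
  have e3 := hT _ (hγ.2 x)
  have e4 := hT _ (hα.2 (α x))
  have e5 := hT _ (hβ.2 (α x))
  have e6 := hT _ (hα.2 (β x))
  have e7 := hT _ (hβ.2 (β x))
  have e9 := hT _ (hβ.2 (γ x))
  simp only [jord, eadd, emul, hα.1.map_max, hβ.1.map_max, e1.2, e2.2, e3.2, e4.2, e5.2, e6.2,
    e7.2, e1.1, e2.1, e3.1, e9.1, max_self]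
  ac_rfl
end

section
/- Let n, k be positive integers with k ≤ n and let a_0 < a_1 < … < a_{k−1} be elements of C_n. If α ∈ σ^(n){a_0,…,a_{k−1}} is a right identity of the simplex (i.e., α(a_i) = a_i for all i = 0,…,k−1), then the Jordan map ∂_α is a derivation on the whole simplex: for all β, γ ∈ σ^(n){a_0,…,a_{k−1}}, ∂_α(βγ) = ∂_α(β)γ + β∂_α(γ). -/
/-- Membership in the simplex `σ^(n){a_0,…,a_{k-1}}`: monotone with image
contained in `{a_0,…,a_{k-1}}`. -/
def inSimplex {n k : ℕ} (a : Fin k → Fin n) (f : Fin n → Fin n) : Prop :=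
  Monotone f ∧ ∀ x, ∃ i, f x = a i

theorem jordan_deriv_simplex_right_identity {n k : ℕ} (hk : 0 < k) (hkn : k ≤ n)
    (a : Fin k → Fin n) (ha : StrictMono a)
    (α : Fin n → Fin n) (hα : inSimplex a α)
    (ht : ∀ i : Fin k, α (a i) = a i)
    (β γ : Fin n → Fin n) (hβ : inSimplex a β) (hγ : inSimplex a γ) :
    jord α (emul β γ) = eadd (emul (jord α β) γ) (emul β (jord α γ)) := by
  have h1 : ∀ x, α (β x) = β x := fun x => by
    obtain ⟨i, hi⟩ := hβ.2 x
    rw [hi, ht]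
  have h2 : ∀ x, α (γ x) = γ x := fun x => by
    obtain ⟨i, hi⟩ := hγ.2 x
    rw [hi, ht]
  funext x
  simp only [jord, eadd, emul, h1, h2, hγ.1.map_max, max_self, max_assoc]
end

section
/- Let n, k be positive integers with k ≤ n and let a_0 < a_1 < … < a_{k−1} be elements of C_n. If α ∈ σ^(n){a_0,…,a_{k−1}} has type (a_0, a_0, …, a_0) (i.e., α(a_i) = a_0 for all i = 0,…,k−1), then the Jordan map ∂_α is a derivation on the whole simplex: for all β, γ ∈ σ^(n){a_0,…,a_{k−1}}, ∂_α(βγ) = ∂_α(β)γ + β∂_α(γ). -/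
theorem jordan_deriv_simplex_type_a0 {n k : ℕ} (hk : 0 < k) (hkn : k ≤ n)
    (a : Fin k → Fin n) (ha : StrictMono a)
    (α : Fin n → Fin n) (hα : inSimplex a α)
    (ht : ∀ i : Fin k, α (a i) = a ⟨0, hk⟩)
    (β γ : Fin n → Fin n) (hβ : inSimplex a β) (hγ : inSimplex a γ) :
    jord α (emul β γ) = eadd (emul (jord α β) γ) (emul β (jord α γ)) := by
  have h0 : ∀ f, inSimplex a f → ∀ x, a ⟨0, hk⟩ ≤ f x := by
    intro f hf x
    obtain ⟨i, hi⟩ := hf.2 x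
    rw [hi]
    exact ha.monotone (Nat.zero_le _)
  have h1 : ∀ f, inSimplex a f → ∀ x, α (f x) = a ⟨0, hk⟩ := by
    intro f hf x
    obtain ⟨i, hi⟩ := hf.2 x
    rw [hi, ht]
  funext x
  simp only [jord, eadd, emul]
  rw [h1 γ hγ, h1 β hβ, max_eq_left (h0 γ hγ _), max_eq_left (h0 β hβ _),
    max_eq_left (h0 γ hγ _), max_eq_left (hγ.1 (h0 β hβ _))]
end

section
/- Let n, k be positive integers with k ≤ n and let a_0 < a_1 < … < a_{k−1} be elements of C_n. If α ∈ σ^(n){a_0,…,a_{k−1}} has type (a_{k−1}, a_{k−1}, …, a_{k−1}) (i.e., α(a_i) = a_{k−1} for all i = 0,…,k−1), then the Jordan map ∂_α is a derivation on the whole simplex: for all β, γ ∈ σ^(n){a_0,…,a_{k−1}}, ∂_α(βγ) = ∂_α(β)γ + β∂_α(γ). -/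
theorem jordan_deriv_simplex_type_last {n k : ℕ} (hk : 0 < k) (hkn : k ≤ n)
    (a : Fin k → Fin n) (ha : StrictMono a)
    (α : Fin n → Fin n) (hα : inSimplex a α)
    (ht : ∀ i : Fin k, α (a i) = a ⟨k - 1, by omega⟩)
    (β γ : Fin n → Fin n) (hβ : inSimplex a β) (hγ : inSimplex a γ) :
    jord α (emul β γ) = eadd (emul (jord α β) γ) (emul β (jord α γ)) := by
  have hle : ∀ f, inSimplex a f → ∀ x, f x ≤ a ⟨k - 1, by omega⟩ := by
    intro f hf x
    obtain ⟨i, hi⟩ := hf.2 x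
    rw [hi]
    apply ha.monotone
    rw [Fin.le_def]
    have := i.2
    simp only
    omega
  have htop : ∀ f, inSimplex a f → ∀ x, α (f x) = a ⟨k - 1, by omega⟩ := by
    intro f hf x
    obtain ⟨i, hi⟩ := hf.2 x
    rw [hi, ht]
  funext x
  simp only [jord, eadd, emul]
  rw [htop γ hγ, max_eq_right (hle γ hγ _), max_eq_right (hle γ hγ _),
    max_eq_right (hle γ hγ _)]
end

section
/- Let n, k be positive integers with k ≤ n and let a_0 < a_1 < … < a_{k−1} be elements of C_n. Let α, β ∈ σ^(n){a_0,…,a_{k−1}} be of the same type (α(a_i) = β(a_i) for all i) and satisfy one of: (a) α and β are both right identities of the simplex (α(a_i) = a_i for all i); (b) there exists ℓ ∈ {0,…,k−1} such that α and β both have type (a_ℓ,…,a_ℓ); (c) the common type is of idempotent form, i.e., the monotone map t : {0,…,k−1} → {0,…,k−1} defined by α(a_i) = a_{t(i)} satisfies t(t(i)) = t(i) for all i. Then the local derivations ∂_α and ∂_β commute on the semiring of right identities of the simplex: for every γ ∈ σ^(n){a_0,…,a_{k−1}} with γ(a_i) = a_i for all i, one has ∂_α(∂_β(γ)) = ∂_β(∂_α(γ)).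 -/
theorem local_derivations_commute_on_RI_simplex {n k : ℕ} (hk : 0 < k) (hkn : k ≤ n)
    (a : Fin k → Fin n) (ha : StrictMono a)
    (α β : Fin n → Fin n) (hα : inSimplex a α) (hβ : inSimplex a β)
    (hsame : ∀ i : Fin k, α (a i) = β (a i))
    (hcase :
      (∀ i : Fin k, α (a i) = a i) ∨
      (∃ ℓ : Fin k, ∀ i : Fin k, α (a i) = a ℓ) ∨
      (∃ t : Fin k → Fin k, Monotone t ∧ (∀ i, t (t i) = t i) ∧ ∀ i, α (a i) = a (t i))) :
    ∀ γ : Fin n → Fin n, inSimplex a γ → (∀ i : Fin k, γ (a i) = a i) →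
      jord α (jord β γ) = jord β (jord α γ) := by
  intro γ hγ hid
  funext x
  obtain ⟨i, hi⟩ := hα.2 x
  obtain ⟨j, hj⟩ := hβ.2 x
  obtain ⟨m, hm⟩ := hγ.2 x
  obtain ⟨p, hp⟩ := hβ.2 (a m)
  have hp' : α (a m) = a p := (hsame m).trans hp
  have hg : ∀ y, γ (β y) = β y := fun y => by
    obtain ⟨q, hq⟩ := hβ.2 y
    rw [hq, hid]
  simp only [jord, eadd, emul, hi, hj, hm, hid, hg, hp, hp', hα.1.map_max, hβ.1.map_max, hsame,
    max_self]
  rw [← max_assoc, ← max_assoc, max_comm (β (a i))]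
end
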